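/- Let θ : ℕ → ℝ be a sequence of real numbers and for s > 0 and a positive integer N define the pair count c(s,N) = #{(j,k,i) : 1 ≤ j, k ≤ N, j ≠ k, i ∈ ℤ, |θ_j − θ_k + i| < s/(2N)}. Let 0 < ε < 1 and let N, N' be positive integers with (1−ε)·N' < N < N'. Then (1/N)·c(s,N) ≤ (1/(1−ε)) · (1/N')·c(s/(1−ε), N'). -/

import Mathlib

open Filter

/-- The pair count `c(s,N) = #{(j,k,i) : 1 ≤ j ≠ k ≤ N, i ∈ ℤ, |θ_j − θ_k + i| < s/(2N)}`. -/
noncomputable def pairCount (θ : ℕ → ℝ) (s : ℝ) (N : ℕ) : ℕ :=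
  Set.ncard {t : ℕ × ℕ × ℤ |
    1 ≤ t.1 ∧ t.1 ≤ N ∧ 1 ≤ t.2.1 ∧ t.2.1 ≤ N ∧ t.1 ≠ t.2.1 ∧
    |θ t.1 - θ t.2.1 + (t.2.2 : ℝ)| < s / (2 * N)}

/-- The set of triples counted by `pairCount` is finite at every scale. -/
theorem finite_pairCount_set (θ : ℕ → ℝ) (r : ℝ) (N : ℕ) :
    {t : ℕ × ℕ × ℤ |
      1 ≤ t.1 ∧ t.1 ≤ N ∧ 1 ≤ t.2.1 ∧ t.2.1 ≤ N ∧ t.1 ≠ t.2.1 ∧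
      |θ t.1 - θ t.2.1 + (t.2.2 : ℝ)| < r}.Finite := by
  have hfin : (⋃ j ∈ Set.Iic N, ⋃ k ∈ Set.Iic N,
      (fun i : ℤ => (j, k, i)) '' Set.Icc ⌊-(θ j - θ k) - r⌋ ⌈-(θ j - θ k) + r⌉).Finite :=
    (Set.finite_Iic N).biUnion fun j _ => (Set.finite_Iic N).biUnion fun k _ =>
      (Set.finite_Icc _ _).image _
  refine hfin.subset ?_
  rintro ⟨j, k, i⟩ ⟨-, hj, -, hk, -, hi⟩
  simp only at hj hk hi
  rw [abs_lt] at hi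
  simp only [Set.mem_iUnion]
  refine ⟨j, hj, k, hk, i, ⟨?_, ?_⟩, rfl⟩
  · exact_mod_cast (Int.floor_le _).trans (by linarith : -(θ j - θ k) - r ≤ (i : ℝ))
  · exact_mod_cast (by linarith : (i : ℝ) ≤ -(θ j - θ k) + r).trans (Int.le_ceil _)

/-- The pair count grows with the number of points and with the scale `s / (2 * N)`. -/
theorem pairCount_le_pairCount (θ : ℕ → ℝ) {s s' : ℝ} {N N' : ℕ} (hN : N ≤ N')
    (hs : s / (2 * N) ≤ s' / (2 * N')) : pairCount θ s N ≤ pairCount θ s' N' :=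
  Set.ncard_le_ncard
    (fun _ ⟨hj, hjN, hk, hkN, hjk, hi⟩ =>
      ⟨hj, hjN.trans hN, hk, hkN.trans hN, hjk, hi.trans_le hs⟩)
    (finite_pairCount_set θ _ N')

/-- (Monotonicity property of the pair count.) If `(1−ε)·N' < N < N'`,
then `(1/N)·c(s,N) ≤ (1/(1−ε)) · (1/N')·c(s/(1−ε), N')`. -/
theorem pairCount_monotonicity
    (θ : ℕ → ℝ) (s ε : ℝ) (hs : 0 < s) (hε : 0 < ε) (hε1 : ε < 1)
    (N N' : ℕ) (hN : 0 < N) (hN' : 0 < N')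
    (h₁ : (1 - ε) * (N' : ℝ) < (N : ℝ)) (h₂ : N < N') :
    (pairCount θ s N : ℝ) / (N : ℝ) ≤
      (1 / (1 - ε)) * ((pairCount θ (s / (1 - ε)) N' : ℝ) / (N' : ℝ)) := by
  have hε' : 0 < 1 - ε := by linarith
  have hNR : (0 : ℝ) < N := by exact_mod_cast hN
  have hNR' : (0 : ℝ) < N' := by exact_mod_cast hN'
  have hscale : s / (2 * N) ≤ s / (1 - ε) / (2 * N') := by
    rw [div_div]
    exact div_le_div_of_nonneg_left hs.le (by positivity) (by linarith)
  have hcount : (pairCount θ s N : ℝ) ≤ pairCount θ (s / (1 - ε)) N' := by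
    exact_mod_cast pairCount_le_pairCount θ h₂.le hscale
  rw [div_mul_div_comm, one_mul]
  exact div_le_div₀ (by positivity) hcount (by positivity) h₁.le
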